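/- (Exactness of the DGN coupled reduced ODE.) Let F : ℝ × ℝ^{m×n} → ℝ^{m×n}, let N : [t0, t0+h] → ℝ^{m×n} be differentiable with Ṅ(t) = F(t, N(t)) for all t ∈ [t0, t0+h]. Let Q1 ∈ ℝ^{m×s1} and Q2 ∈ ℝ^{n×s2} have orthonormal columns, and assume Range(N(t)) ⊆ Range(Q1) and Range(N(t)ᵀ) ⊆ Range(Q2) for all t ∈ [t0, t0+h]. Then D(t) := Q1ᵀ N(t) Q2 is differentiable and solves the s1×s2 differential equation Ḋ(t) = Q1ᵀ F(t, Q1 D(t) Q2ᵀ) Q2 with D(t0) = Q1ᵀ N(t0) Q2, and moreover N(t) = Q1 D(t) Q2ᵀ for all t ∈ [t0, t0+h]. -/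

import Mathlib

open scoped Matrix

attribute [local instance] Matrix.frobeniusNormedAddCommGroup Matrix.frobeniusNormedSpace

/-- If `Q` has orthonormal columns and the column space of `A` lies in that of `Q`, then the
orthogonal projection `Q * Qᵀ` fixes `A`. -/
theorem mul_transpose_mul_eq_of_range_le {l k p : Type*} [Fintype k] [Fintype l] [Fintype p]
    [DecidableEq k] [DecidableEq p] {Q : Matrix l k ℝ} {A : Matrix l p ℝ} (hQ : Qᵀ * Q = 1)
    (hA : LinearMap.range A.mulVecLin ≤ LinearMap.range Q.mulVecLin) :
    Q * (Qᵀ * A) = A := by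
  refine Matrix.ext_of_mulVec_single fun i => ?_
  obtain ⟨x, hx⟩ := hA ⟨Pi.single i 1, rfl⟩
  simp only [Matrix.mulVecLin_apply] at hx
  rw [← Matrix.mulVec_mulVec, ← Matrix.mulVec_mulVec, ← hx, Matrix.mulVec_mulVec x Qᵀ Q, hQ,
    Matrix.one_mulVec]

/-- Exactness of the DGN coupled reduced ODE: if `Ṅ(t) = F(t, N(t))` on `[t0, t0+h]`,
`Q1, Q2` have orthonormal columns, `Range(N(t)) ⊆ Range(Q1)` and `Range(N(t)ᵀ) ⊆ Range(Q2)`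
for all `t`, then `D(t) = Q1ᵀ N(t) Q2` solves `Ḋ(t) = Q1ᵀ F(t, Q1 D(t) Q2ᵀ) Q2` with
`D(t0) = Q1ᵀ N(t0) Q2`, and moreover `N(t) = Q1 D(t) Q2ᵀ` for all `t`. -/
theorem dgn_reduced_ode_exact {m n s1 s2 : ℕ}
    (F : ℝ → Matrix (Fin m) (Fin n) ℝ → Matrix (Fin m) (Fin n) ℝ)
    (t0 h : ℝ) (N : ℝ → Matrix (Fin m) (Fin n) ℝ)
    (hN : ∀ t ∈ Set.Icc t0 (t0 + h), HasDerivAt N (F t (N t)) t)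
    (Q1 : Matrix (Fin m) (Fin s1) ℝ) (Q2 : Matrix (Fin n) (Fin s2) ℝ)
    (hQ1 : Q1ᵀ * Q1 = 1) (hQ2 : Q2ᵀ * Q2 = 1)
    (hr : ∀ t ∈ Set.Icc t0 (t0 + h),
      LinearMap.range (N t).mulVecLin ≤ LinearMap.range Q1.mulVecLin)
    (hc : ∀ t ∈ Set.Icc t0 (t0 + h),
      LinearMap.range (N t)ᵀ.mulVecLin ≤ LinearMap.range Q2.mulVecLin) :
    ∀ t ∈ Set.Icc t0 (t0 + h),
      HasDerivAt (fun u : ℝ => Q1ᵀ * N u * Q2)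
        (Q1ᵀ * F t (Q1 * (Q1ᵀ * N t * Q2) * Q2ᵀ) * Q2) t ∧
      N t = Q1 * (Q1ᵀ * N t * Q2) * Q2ᵀ := by
  have hproj : ∀ t ∈ Set.Icc t0 (t0 + h), N t = Q1 * (Q1ᵀ * N t * Q2) * Q2ᵀ := by
    intro t ht
    have hcol := mul_transpose_mul_eq_of_range_le hQ1 (hr t ht)
    have hrow := congrArg Matrix.transpose (mul_transpose_mul_eq_of_range_le hQ2 (hc t ht))
    simp only [Matrix.transpose_mul, Matrix.transpose_transpose] at hrow
    rw [← Matrix.mul_assoc Q1, hcol, hrow]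
  intro t ht
  refine ⟨?_, hproj t ht⟩
  rw [← hproj t ht]
  let L : Matrix (Fin m) (Fin n) ℝ →ₗ[ℝ] Matrix (Fin s1) (Fin s2) ℝ :=
    { toFun := fun A => Q1ᵀ * A * Q2
      map_add' := fun A B => by rw [Matrix.mul_add, Matrix.add_mul]
      map_smul' := fun c A => by simp }
  exact L.toContinuousLinearMap.hasFDerivAt.comp_hasDerivAt t (hN t ht)
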